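/- arXiv:1204.3869 — 2 statements merged into one kernel-verified Lean document; each statement's English description precedes it below -/
import Mathlib

section
/- 𝒫(X) = ker ℐ(X), where ℐ(X) ⊆ ℝ[t_1,…,t_r] is the ideal generated by the powers p̃_η^{m(η)} over all η ∈ ℝ^r∖{0}, with m(η) := #{x ∈ X : η·x ≠ 0}. -/
noncomputable section

variable {r N : ℕ}

/-- `p_u`, the degree-one polynomial associated with the vector `u ∈ ℝ^r`. -/
def linPoly {r : ℕ} (u : Fin r → ℝ) : MvPolynomial (Fin r) ℝ :=
  ∑ i, MvPolynomial.C (u i) * MvPolynomial.X i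

/-- `p_Y = ∏_{i ∈ Y} p_{X i}` for a sublist `Y` of the list `X`. -/
def prodPoly {r N : ℕ} (X : Fin N → Fin r → ℝ) (Y : Finset (Fin N)) : MvPolynomial (Fin r) ℝ :=
  ∏ i ∈ Y, linPoly (X i)

/-- The pairing `⟨p, f⟩ = (p(∂/∂t₁,…,∂/∂t_r) f)(0)`, written via coefficients:
`⟨p,f⟩ = ∑_α α! · p_α · f_α`. -/
def pairing {r : ℕ} (p f : MvPolynomial (Fin r) ℝ) : ℝ :=
  ∑ α ∈ p.support, (∏ i, ((α i).factorial : ℝ)) * p.coeff α * f.coeff α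

lemma pairing_zero {r : ℕ} (q : MvPolynomial (Fin r) ℝ) : pairing q 0 = 0 := by
  simp [pairing]

lemma pairing_add {r : ℕ} (q f g : MvPolynomial (Fin r) ℝ) :
    pairing q (f + g) = pairing q f + pairing q g := by
  unfold pairing
  rw [← Finset.sum_add_distrib]
  exact Finset.sum_congr rfl fun α _ => by rw [MvPolynomial.coeff_add]; ring

lemma pairing_smul {r : ℕ} (q : MvPolynomial (Fin r) ℝ) (c : ℝ) (f : MvPolynomial (Fin r) ℝ) :
    pairing q (c • f) = c * pairing q f := by
  unfold pairing
  rw [Finset.mul_sum]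
  exact Finset.sum_congr rfl fun α _ => by rw [MvPolynomial.coeff_smul, smul_eq_mul]; ring

/-- The kernel (Macaulay inverse system) of an ideal `I`:
all polynomials annihilated (in the sense of the pairing) by every element of `I`. -/
def kerIdeal {r : ℕ} (I : Ideal (MvPolynomial (Fin r) ℝ)) :
    Submodule ℝ (MvPolynomial (Fin r) ℝ) where
  carrier := {f | ∀ q ∈ I, pairing q f = 0}
  add_mem' := fun hf hg q hq => by
    rw [pairing_add, hf q hq, hg q hq, add_zero]
  zero_mem' := fun q _ => pairing_zero q
  smul_mem' := fun c f hf q hq => by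
    rw [pairing_smul, hf q hq, mul_zero]

section Lists

variable {M : Type*} [AddCommGroup M] [Module ℝ M]

/-- `B ⊆ G` is (the index set of) a sublist of the list `v` restricted to the ground set `G`
that is a basis of the ambient space. -/
def basesOn (v : Fin N → M) (G : Finset (Fin N)) : Set (Finset (Fin N)) :=
  {B | B ⊆ G ∧ LinearIndependent ℝ ((B : Set (Fin N)).restrict v) ∧
    Submodule.span ℝ (v '' (B : Set (Fin N))) = ⊤}

/-- `j` is externally active with respect to the basis `B`:
`v j ∈ span {v e : e ∈ B, e ≤ j}` and `j ∉ B`. -/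
def isExtActive (v : Fin N → M) (B : Finset (Fin N)) (j : Fin N) : Prop :=
  j ∉ B ∧ v j ∈ Submodule.span ℝ (v '' {e : Fin N | e ∈ B ∧ e ≤ j})

open Classical in
/-- The set `E(B)` of externally active elements (within the ground set `G`). -/
def extSetOn (v : Fin N → M) (G B : Finset (Fin N)) : Finset (Fin N) :=
  G.filter (fun j => isExtActive v B j)

/-- `C` is a cocircuit w.r.t. the collection of bases `𝔅`: an inclusion-minimal
sublist of the ground set `G` intersecting every basis in `𝔅`. -/
def isCocircuitOn (G : Finset (Fin N)) (𝔅 : Set (Finset (Fin N))) (C : Finset (Fin N)) : Prop :=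
  C ⊆ G ∧ (∀ B ∈ 𝔅, (C ∩ B).Nonempty) ∧
    ∀ C' ⊆ C, (∀ B ∈ 𝔅, (C' ∩ B).Nonempty) → C' = C

/-- A set of bases `𝔅` of the list `v` has the forward exchange property. -/
def forwardExchange (v : Fin N → M) (𝔅 : Set (Finset (Fin N))) : Prop :=
  ∀ B ∈ 𝔅, ∀ b ∈ B, ∀ j : Fin N,
    v j ∈ Submodule.span ℝ (v '' {e : Fin N | e ∈ B ∧ e ≤ b}) →
    v j ∉ Submodule.span ℝ (v '' {e : Fin N | e ∈ B ∧ e < b}) →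
    ¬ isExtActive v B j →
    insert j (B.erase b) ∈ 𝔅

end Lists

/-- The ideal `𝒥` generated by the cocircuit polynomials `p_C`. -/
def Jideal (X : Fin N → Fin r → ℝ) (G : Finset (Fin N)) (𝔅 : Set (Finset (Fin N))) :
    Ideal (MvPolynomial (Fin r) ℝ) :=
  Ideal.span {p | ∃ C : Finset (Fin N), isCocircuitOn G 𝔅 C ∧ p = prodPoly X C}

/-- The generalised `𝒟`-space: the kernel of the cocircuit ideal. -/
def Dspace (X : Fin N → Fin r → ℝ) (G : Finset (Fin N)) (𝔅 : Set (Finset (Fin N))) :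
    Submodule ℝ (MvPolynomial (Fin r) ℝ) :=
  kerIdeal (Jideal X G 𝔅)

/-- `Q_B := p_{X∖(B ∪ E(B))}` (within the ground set `G`). -/
def QB (X : Fin N → Fin r → ℝ) (G B : Finset (Fin N)) : MvPolynomial (Fin r) ℝ :=
  prodPoly X (G \ (B ∪ extSetOn X G B))

/-- The central `𝒫`-space: the span of `p_Y` over sublists `Y` of `G` whose complement spans. -/
def PspaceOn (X : Fin N → Fin r → ℝ) (G : Finset (Fin N)) :
    Submodule ℝ (MvPolynomial (Fin r) ℝ) :=
  Submodule.span ℝ {p | ∃ Y : Finset (Fin N), Y ⊆ G ∧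
    Submodule.span ℝ (X '' ((G \ Y : Finset (Fin N)) : Set (Fin N))) = ⊤ ∧ p = prodPoly X Y}

/-- The generalised `𝒫`-space `𝒫(X,𝔅') = span {Q_B : B ∈ 𝔅'}`. -/
def PspaceB (X : Fin N → Fin r → ℝ) (G : Finset (Fin N)) (𝔅 : Set (Finset (Fin N))) :
    Submodule ℝ (MvPolynomial (Fin r) ℝ) :=
  Submodule.span ℝ {p | ∃ B ∈ 𝔅, p = QB X G B}

/-- The directional derivative `D_u = ∑ i, uᵢ ∂/∂tᵢ` as a linear map. -/
def dirDeriv {r : ℕ} (u : Fin r → ℝ) :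
    MvPolynomial (Fin r) ℝ →ₗ[ℝ] MvPolynomial (Fin r) ℝ :=
  ∑ i, u i • (MvPolynomial.pderiv i).toLinearMap

end

open MvPolynomial in
/-- The restriction `t ↦ f (w + t η)` of `f` to the line through `w` with direction `η`. -/
noncomputable def lineRestrict {r : ℕ} (w η : Fin r → ℝ) :
    MvPolynomial (Fin r) ℝ →ₐ[ℝ] Polynomial ℝ :=
  aeval fun i => Polynomial.C (w i) + Polynomial.C (η i) * Polynomial.X

/-- `m(η)`, counted within the ground set `S`. -/
noncomputable def directionOrder {r N : ℕ} (X : Fin N → Fin r → ℝ) (S : Finset (Fin N))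
    (η : Fin r → ℝ) : ℕ :=
  (S.filter fun i => X i ⬝ᵥ η ≠ 0).card

/-- The vectors indexed by `T`, as linear forms, have no common zero on `W` except `0`. -/
def Separates {r N : ℕ} (X : Fin N → Fin r → ℝ) (T : Finset (Fin N))
    (W : Submodule ℝ (Fin r → ℝ)) : Prop :=
  ∀ η ∈ W, (∀ i ∈ T, X i ⬝ᵥ η = 0) → η = 0

/-- The span of the `p_Y` for which the complement of `Y` in `S` separates `W`. -/
noncomputable def separatingSpan {r N : ℕ} (X : Fin N → Fin r → ℝ) (S : Finset (Fin N))
    (W : Submodule ℝ (Fin r → ℝ)) : Submodule ℝ (MvPolynomial (Fin r) ℝ) :=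
  Submodule.span ℝ {p | ∃ Y ⊆ S, Separates X (S \ Y) W ∧ p = prodPoly X Y}

section Lines

variable {r : ℕ}

lemma eval_linPoly (u w : Fin r → ℝ) : MvPolynomial.eval w (linPoly u) = u ⬝ᵥ w := by
  simp [linPoly, dotProduct]

lemma lineRestrict_linPoly (w η u : Fin r → ℝ) :
    lineRestrict w η (linPoly u) =
      Polynomial.C (u ⬝ᵥ η) * Polynomial.X + Polynomial.C (u ⬝ᵥ w) := by
  simp only [lineRestrict, linPoly, dotProduct, map_sum, map_mul, MvPolynomial.aeval_X,
    MvPolynomial.algHom_C, Finset.sum_mul, ← Finset.sum_add_distrib]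
  refine Finset.sum_congr rfl fun i _ => ?_
  rw [Polynomial.algebraMap_eq]
  ring

lemma eval_lineRestrict (w η : Fin r → ℝ) (f : MvPolynomial (Fin r) ℝ) (t : ℝ) :
    (lineRestrict w η f).eval t = MvPolynomial.eval (w + t • η) f := by
  induction f using MvPolynomial.induction_on with
  | C a => simp [lineRestrict]
  | add p q hp hq => simp [hp, hq]
  | mul_X p i hp =>
    simp only [map_mul, Polynomial.eval_mul, hp, MvPolynomial.eval_X]
    simp [lineRestrict, mul_comm t]

lemma lineRestrict_congr {W : Submodule ℝ (Fin r → ℝ)} {f g : MvPolynomial (Fin r) ℝ}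
    (h : ∀ w ∈ W, MvPolynomial.eval w f = MvPolynomial.eval w g) {w η : Fin r → ℝ}
    (hw : w ∈ W) (hη : η ∈ W) : lineRestrict w η f = lineRestrict w η g :=
  Polynomial.funext fun t => by
    rw [eval_lineRestrict, eval_lineRestrict, h _ (W.add_mem hw (W.smul_mem t hη))]

/-- The coefficients of `f (w + s e + t η)` in `t` are polynomials in `s`. -/
lemma exists_coeff_lineRestrict (w e η : Fin r → ℝ) (f : MvPolynomial (Fin r) ℝ) (k : ℕ) :
    ∃ q : Polynomial ℝ, ∀ s : ℝ, (lineRestrict (w + s • e) η f).coeff k = q.eval s := by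
  let F : MvPolynomial (Fin r) ℝ →ₐ[ℝ] Polynomial (Polynomial ℝ) :=
    MvPolynomial.aeval fun i =>
      Polynomial.C (Polynomial.C (w i) + Polynomial.C (e i) * Polynomial.X) +
        Polynomial.C (Polynomial.C (η i)) * Polynomial.X
  have hF : ∀ s : ℝ, lineRestrict (w + s • e) η f = (F f).map (Polynomial.evalRingHom s) := by
    intro s
    induction f using MvPolynomial.induction_on with
    | C a => simp [lineRestrict, F]
    | add p q hp hq => simp [hp, hq]
    | mul_X p i hp =>
      simp only [map_mul, Polynomial.map_mul, hp]
      simp [lineRestrict, F, mul_comm s]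
  exact ⟨(F f).coeff k, fun s => by rw [hF, Polynomial.coeff_map, Polynomial.coe_evalRingHom]⟩

lemma degree_lineRestrict_lt_of_mul_of_eq_zero {W : Submodule ℝ (Fin r → ℝ)}
    {u e η : Fin r → ℝ} {h : MvPolynomial (Fin r) ℝ} {m : ℕ} (he : e ∈ W) (hue : u ⬝ᵥ e ≠ 0)
    (huη : u ⬝ᵥ η = 0) (hm : ∀ w ∈ W, (lineRestrict w η (linPoly u * h)).degree < m) :
    ∀ w ∈ W, (lineRestrict w η h).degree < m := by
  intro w hw
  rw [Polynomial.degree_lt_iff_coeff_zero]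
  intro k hk
  obtain ⟨q, hq⟩ := exists_coeff_lineRestrict w e η h k
  have hzero : (Polynomial.C (u ⬝ᵥ e) * Polynomial.X + Polynomial.C (u ⬝ᵥ w)) * q = 0 := by
    refine Polynomial.funext fun s => ?_
    have := (Polynomial.degree_lt_iff_coeff_zero _ _).1
      (hm (w + s • e) (W.add_mem hw (W.smul_mem s he))) k hk
    rw [map_mul, lineRestrict_linPoly, huη, Polynomial.C_0, zero_mul, zero_add,
      Polynomial.coeff_C_mul, hq, dotProduct_add, dotProduct_smul, smul_eq_mul] at this
    simp only [Polynomial.eval_mul, Polynomial.eval_add, Polynomial.eval_C, Polynomial.eval_X,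
      Polynomial.eval_zero]
    linear_combination this
  have hq0 : q = 0 := by
    refine (mul_eq_zero.1 hzero).resolve_left fun h0 => ?_
    have := Polynomial.degree_linear (b := u ⬝ᵥ w) hue
    simp [h0] at this
  simpa [hq0] using hq 0

lemma degree_lineRestrict_lt_of_mul_of_ne_zero {u w η : Fin r → ℝ}
    {h : MvPolynomial (Fin r) ℝ} {m : ℕ} (huη : u ⬝ᵥ η ≠ 0)
    (hm : (lineRestrict w η (linPoly u * h)).degree < (m + 1 : ℕ)) :
    (lineRestrict w η h).degree < m := by
  rw [map_mul, lineRestrict_linPoly, Polynomial.degree_mul, Polynomial.degree_linear huη] at hm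
  rcases eq_or_ne (lineRestrict w η h) 0 with h0 | h0
  · simp [h0]
  · rw [Polynomial.degree_eq_natDegree h0] at hm ⊢
    norm_cast at hm ⊢
    omega

lemma linPoly_dvd_sub_bind₁ (u e : Fin r → ℝ) (f : MvPolynomial (Fin r) ℝ) :
    linPoly u ∣ f - MvPolynomial.bind₁
      (fun i => MvPolynomial.X i - MvPolynomial.C (e i) * linPoly u) f := by
  induction f using MvPolynomial.induction_on with
  | C a => simp
  | add p q hp hq =>
    rw [map_add, add_sub_add_comm]
    exact dvd_add hp hq
  | mul_X p i hp =>
    obtain ⟨c, hc⟩ := hp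
    rw [sub_eq_iff_eq_add] at hc
    simp only [map_mul, MvPolynomial.bind₁_X_right]
    refine ⟨c * MvPolynomial.X i + MvPolynomial.bind₁
      (fun i => MvPolynomial.X i - MvPolynomial.C (e i) * linPoly u) p *
        MvPolynomial.C (e i), ?_⟩
    linear_combination MvPolynomial.X i * hc

/-- A polynomial vanishing on the zero locus in `W` of a nonzero linear form agrees on `W` with
a multiple of that form. -/
lemma exists_eval_eq_linPoly_mul {W : Submodule ℝ (Fin r → ℝ)} {u e : Fin r → ℝ} (he : e ∈ W)
    (hue : u ⬝ᵥ e ≠ 0) {f : MvPolynomial (Fin r) ℝ}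
    (hf : ∀ w ∈ W, u ⬝ᵥ w = 0 → MvPolynomial.eval w f = 0) :
    ∃ h, ∀ w ∈ W, MvPolynomial.eval w f = MvPolynomial.eval w (linPoly u * h) := by
  obtain ⟨h, hh⟩ := linPoly_dvd_sub_bind₁ u ((u ⬝ᵥ e)⁻¹ • e) f
  refine ⟨h, fun w hw => ?_⟩
  have hproj : MvPolynomial.eval w (MvPolynomial.bind₁ (fun i => MvPolynomial.X i -
      MvPolynomial.C (((u ⬝ᵥ e)⁻¹ • e) i) * linPoly u) f) =
      MvPolynomial.eval (w - (u ⬝ᵥ w) • (u ⬝ᵥ e)⁻¹ • e) f := by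
    rw [← MvPolynomial.coe_aeval_eq_eval, RingHom.coe_coe, MvPolynomial.aeval_bind₁,
      ← MvPolynomial.coe_aeval_eq_eval, RingHom.coe_coe]
    congr 2
    ext i
    simp only [map_sub, map_mul, MvPolynomial.aeval_eq_eval, MvPolynomial.eval_X,
      MvPolynomial.eval_C, eval_linPoly, Pi.sub_apply, Pi.smul_apply, smul_eq_mul]
    ring
  rw [← hh, map_sub, hproj, hf _ (W.sub_mem hw (W.smul_mem _ (W.smul_mem _ he))), sub_zero]
  rw [dotProduct_sub, dotProduct_smul, dotProduct_smul, smul_eq_mul, smul_eq_mul,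
    inv_mul_cancel₀ hue, mul_one, sub_self]

end Lines

section Separating

variable {r N : ℕ} {X : Fin N → Fin r → ℝ}

lemma Separates.mono {T T' : Finset (Fin N)} {W : Submodule ℝ (Fin r → ℝ)}
    (h : Separates X T W) (hT : T ⊆ T') : Separates X T' W :=
  fun η hη h0 => h η hη fun i hi => h0 i (hT hi)

lemma separates_top_iff (T : Finset (Fin N)) :
    Separates X T ⊤ ↔ Submodule.span ℝ (X '' (T : Set (Fin N))) = ⊤ := by
  constructor
  · intro h
    by_contra hne
    obtain ⟨φ, hφ, hle⟩ := Submodule.exists_le_ker_of_lt_top _ (lt_top_iff_ne_top.2 hne)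
    have hφ_apply : ∀ x, φ x = x ⬝ᵥ fun i => φ fun j => if i = j then 1 else 0 :=
      fun x => φ.pi_apply_eq_sum_univ x
    have h0 := h (fun i => φ fun j => if i = j then 1 else 0) trivial fun i hi => by
      rw [← hφ_apply]
      exact hle (Submodule.subset_span ⟨i, hi, rfl⟩)
    exact hφ (LinearMap.ext fun x => by rw [hφ_apply, h0, dotProduct_zero, LinearMap.zero_apply])
  · intro h η _ h0
    have hmem : η ∈ Submodule.span ℝ (X '' (T : Set (Fin N))) := h ▸ Submodule.mem_top
    refine dotProduct_self_eq_zero.1 ?_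
    refine Submodule.span_induction (p := fun x _ => x ⬝ᵥ η = 0) ?_ ?_ ?_ ?_ hmem
    · rintro _ ⟨i, hi, rfl⟩
      exact h0 i hi
    · exact zero_dotProduct η
    · intro x y _ _ hx hy
      rw [add_dotProduct, hx, hy, add_zero]
    · intro c x _ hx
      rw [smul_dotProduct, hx, smul_zero]

lemma degree_lineRestrict_prodPoly_le (Y : Finset (Fin N)) (w η : Fin r → ℝ) :
    (lineRestrict w η (prodPoly X Y)).degree ≤ directionOrder X Y η := by
  rw [prodPoly, map_prod, directionOrder, Finset.card_filter, Nat.cast_sum]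
  refine (Polynomial.degree_prod_le _ _).trans (Finset.sum_le_sum fun i _ => ?_)
  rw [lineRestrict_linPoly]
  split_ifs with h
  · exact Polynomial.degree_linear_le
  · rw [not_ne_iff.1 h, Polynomial.C_0, zero_mul, zero_add]
    exact Polynomial.degree_C_le

lemma degree_lineRestrict_lt_of_mem_separatingSpan {S : Finset (Fin N)}
    {W : Submodule ℝ (Fin r → ℝ)} {g : MvPolynomial (Fin r) ℝ} (hg : g ∈ separatingSpan X S W)
    {η : Fin r → ℝ} (hη : η ∈ W) (hη0 : η ≠ 0) (w : Fin r → ℝ) :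
    (lineRestrict w η g).degree < directionOrder X S η := by
  rw [← Polynomial.mem_degreeLT, ← AlgHom.toLinearMap_apply, ← Submodule.mem_comap]
  refine Submodule.span_le.2 ?_ hg
  rintro _ ⟨Y, hY, hsep, rfl⟩
  rw [SetLike.mem_coe, Submodule.mem_comap, AlgHom.toLinearMap_apply, Polynomial.mem_degreeLT]
  refine (degree_lineRestrict_prodPoly_le Y w η).trans_lt (Nat.cast_lt.2 ?_)
  obtain ⟨i, hi, hiη⟩ : ∃ i ∈ S \ Y, X i ⬝ᵥ η ≠ 0 := by
    by_contra! h
    exact hη0 (hsep η hη h)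
  rw [Finset.mem_sdiff] at hi
  refine Finset.card_lt_card ⟨Finset.filter_subset_filter _ hY, fun hsub => hi.2 ?_⟩
  exact Finset.filter_subset _ _ (hsub (Finset.mem_filter.2 ⟨hi.1, hiη⟩))

/-- A polynomial whose restriction to each line in `W` of direction `η` has degree less than
`m(η)` agrees on `W` with an element of the `𝒫`-space. -/
theorem exists_mem_separatingSpan_eval_eq (S : Finset (Fin N)) :
    ∀ (W : Submodule ℝ (Fin r → ℝ)), Separates X S W → ∀ f : MvPolynomial (Fin r) ℝ,
      (∀ η ∈ W, η ≠ 0 → ∀ w ∈ W, (lineRestrict w η f).degree < directionOrder X S η) →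
      ∃ g ∈ separatingSpan X S W, ∀ w ∈ W, MvPolynomial.eval w f = MvPolynomial.eval w g := by
  classical
  induction S using Finset.induction_on with
  | empty =>
    intro W hW f _
    refine ⟨MvPolynomial.eval 0 f • 1, Submodule.smul_mem _ _ (Submodule.subset_span
      ⟨∅, subset_rfl, by simpa using hW, by simp [prodPoly]⟩), fun w hw => ?_⟩
    rw [hW w hw (by simp)]
    simp
  | insert a S ha ih =>
    intro W hW f hf
    have horder_zero : ∀ η, X a ⬝ᵥ η = 0 →
        directionOrder X (insert a S) η = directionOrder X S η := fun η h => by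
      simp [directionOrder, Finset.filter_insert, h]
    have horder_succ : ∀ η, X a ⬝ᵥ η ≠ 0 →
        directionOrder X (insert a S) η = directionOrder X S η + 1 := fun η h => by
      simp [directionOrder, Finset.filter_insert, h, ha]
    have hsdiff : ∀ Y ⊆ S, insert a S \ Y = insert a (S \ Y) := fun Y hY =>
      Finset.insert_sdiff_of_notMem _ fun h => ha (hY h)
    let W' : Submodule ℝ (Fin r → ℝ) :=
      { carrier := {w | w ∈ W ∧ X a ⬝ᵥ w = 0}
        add_mem' := fun {x y} hx hy => ⟨W.add_mem hx.1 hy.1, by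
          rw [dotProduct_add, hx.2, hy.2, add_zero]⟩
        zero_mem' := ⟨W.zero_mem, dotProduct_zero _⟩
        smul_mem' := fun c x hx => ⟨W.smul_mem c hx.1, by
          rw [dotProduct_smul, hx.2, smul_zero]⟩ }
    have hsep' : ∀ T, Separates X (insert a T) W ↔ Separates X T W' := fun T => by
      simp only [Separates, Finset.forall_mem_insert]
      exact ⟨fun h η hη h0 => h η hη.1 ⟨hη.2, h0⟩, fun h η hη h0 => h η ⟨hη, h0.1⟩ h0.2⟩
    obtain ⟨g, hg, hfg⟩ := ih W' ((hsep' S).1 hW) f fun η hη hη0 w hw =>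
      horder_zero η hη.2 ▸ hf η hη.1 hη0 w hw.1
    have hgW : g ∈ separatingSpan X (insert a S) W := by
      refine Submodule.span_mono ?_ hg
      rintro _ ⟨Y, hY, hsep, rfl⟩
      exact ⟨Y, hY.trans (Finset.subset_insert a S), hsdiff Y hY ▸ (hsep' _).2 hsep, rfl⟩
    by_cases hzero : ∀ w ∈ W, X a ⬝ᵥ w = 0
    · exact ⟨g, hgW, fun w hw => hfg w ⟨hw, hzero w hw⟩⟩
    push Not at hzero
    obtain ⟨e, he, hae⟩ := hzero
    obtain ⟨h, hh⟩ := exists_eval_eq_linPoly_mul (f := f - g) he hae fun w hw haw => by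
      rw [map_sub, hfg w ⟨hw, haw⟩, sub_self]
    have hdeg : ∀ η ∈ W, η ≠ 0 → ∀ w ∈ W, (lineRestrict w η (linPoly (X a) * h)).degree <
        directionOrder X (insert a S) η := fun η hη hη0 w hw => by
      rw [← lineRestrict_congr hh hw hη, map_sub]
      exact (Polynomial.degree_sub_le _ _).trans_lt (max_lt (hf η hη hη0 w hw)
        (degree_lineRestrict_lt_of_mem_separatingSpan hgW hη hη0 w))
    have hdeg' : ∀ η ∈ W, η ≠ 0 → ∀ w ∈ W,
        (lineRestrict w η h).degree < directionOrder X S η := fun η hη hη0 w hw => by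
      by_cases haη : X a ⬝ᵥ η = 0
      · exact degree_lineRestrict_lt_of_mul_of_eq_zero he hae haη
          (fun w hw => horder_zero η haη ▸ hdeg η hη hη0 w hw) w hw
      · exact degree_lineRestrict_lt_of_mul_of_ne_zero haη
          (horder_succ η haη ▸ hdeg η hη hη0 w hw)
    by_cases hS : Separates X S W
    · obtain ⟨k, hk, hhk⟩ := ih W hS h hdeg'
      refine ⟨g + linPoly (X a) * k, Submodule.add_mem _ hgW ?_, fun w hw => ?_⟩
      · rw [← LinearMap.mulLeft_apply (R := ℝ), ← Submodule.mem_comap]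
        refine Submodule.span_le.2 ?_ hk
        rintro _ ⟨Y, hY, hsep, rfl⟩
        refine Submodule.subset_span ⟨insert a Y, Finset.insert_subset_insert a hY,
          hsep.mono fun i hi => ?_, ?_⟩
        · rw [Finset.mem_sdiff] at hi ⊢
          exact ⟨Finset.mem_insert_of_mem hi.1, fun h => (Finset.mem_insert.1 h).elim
            (fun h => ha (h ▸ hi.1)) hi.2⟩
        · rw [prodPoly, prodPoly, Finset.prod_insert fun h => ha (hY h), LinearMap.mulLeft_apply]
      · have := hh w hw
        rw [map_sub, map_mul, hhk w hw] at this
        rw [map_add, map_mul]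
        linear_combination this
    · simp only [Separates, not_forall] at hS
      obtain ⟨η, hη, h0, hη0⟩ := hS
      have horder : directionOrder X S η = 0 := by
        simpa [directionOrder, Finset.filter_eq_empty_iff] using h0
      refine ⟨g, hgW, fun w hw => ?_⟩
      have hlt := hdeg' η hη hη0 w hw
      rw [horder, Nat.cast_zero] at hlt
      replace hlt := Polynomial.degree_eq_bot.1 (Nat.WithBot.lt_zero_iff.1 hlt)
      have hw0 : MvPolynomial.eval w h = 0 := by
        simpa [hlt] using (eval_lineRestrict w η h 0).symm
      have := hh w hw
      rw [map_sub, map_mul, hw0, mul_zero] at this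
      linear_combination this

end Separating

section Pairing

variable {r : ℕ}

lemma pairing_comm (p f : MvPolynomial (Fin r) ℝ) : pairing p f = pairing f p := by
  have key : ∀ p f : MvPolynomial (Fin r) ℝ, pairing p f =
      ∑ α ∈ p.support ∩ f.support, (∏ i, ((α i).factorial : ℝ)) * p.coeff α * f.coeff α :=
    fun p f => (Finset.sum_subset Finset.inter_subset_left fun α hα hα' => by
      rw [MvPolynomial.notMem_support_iff.1 fun h => hα' (Finset.mem_inter.2 ⟨hα, h⟩),
        mul_zero]).symm
  rw [key, key, Finset.inter_comm]
  exact Finset.sum_congr rfl fun α _ => by ring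

lemma pairing_add_left (p q f : MvPolynomial (Fin r) ℝ) :
    pairing (p + q) f = pairing p f + pairing q f := by
  rw [pairing_comm, pairing_add, pairing_comm f, pairing_comm f]

lemma pairing_smul_left (c : ℝ) (p f : MvPolynomial (Fin r) ℝ) :
    pairing (c • p) f = c * pairing p f := by
  rw [pairing_comm, pairing_smul, pairing_comm f]

lemma pairing_monomial_left (α : Fin r →₀ ℕ) (c : ℝ) (f : MvPolynomial (Fin r) ℝ) :
    pairing (MvPolynomial.monomial α c) f = (∏ i, ((α i).factorial : ℝ)) * c * f.coeff α := by
  classical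
  rcases eq_or_ne c 0 with rfl | hc
  · simp [pairing]
  · simp [pairing, MvPolynomial.support_monomial, hc]

lemma eq_zero_of_forall_pairing_eq_zero {f : MvPolynomial (Fin r) ℝ}
    (h : ∀ p, pairing p f = 0) : f = 0 := by
  ext α
  have := h (MvPolynomial.monomial α 1)
  rw [pairing_monomial_left, mul_one] at this
  exact (mul_eq_zero.1 this).resolve_left
    (Finset.prod_ne_zero_iff.2 fun i _ => Nat.cast_ne_zero.2 (Nat.factorial_ne_zero _))

lemma pairing_X_mul (i : Fin r) (p f : MvPolynomial (Fin r) ℝ) :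
    pairing (MvPolynomial.X i * p) f = pairing p (MvPolynomial.pderiv i f) := by
  induction p using MvPolynomial.induction_on' with
  | monomial α c =>
    rw [MvPolynomial.X, MvPolynomial.monomial_mul, one_mul, pairing_monomial_left,
      pairing_monomial_left, MvPolynomial.coeff_pderiv, add_comm (Finsupp.single i 1) α]
    have : ∏ j, (((α + Finsupp.single i 1 : Fin r →₀ ℕ) j).factorial : ℝ) =
        (∏ j, ((α j).factorial : ℝ)) * (α i + 1) := by
      rw [← Finset.mul_prod_erase _ _ (Finset.mem_univ i),
        ← Finset.mul_prod_erase _ (fun j => ((α j).factorial : ℝ)) (Finset.mem_univ i),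
        Finset.prod_congr rfl fun j hj => by
          rw [Finsupp.add_apply, Finsupp.single_eq_of_ne (Finset.ne_of_mem_erase hj), add_zero]]
      simp only [Finsupp.add_apply, Finsupp.single_eq_same, Nat.factorial_succ]
      push_cast
      ring
    rw [this]
    ring
  | add p q hp hq => rw [mul_add, pairing_add_left, pairing_add_left, hp, hq]

lemma dirDeriv_apply (u : Fin r → ℝ) (f : MvPolynomial (Fin r) ℝ) :
    dirDeriv u f = ∑ i, u i • MvPolynomial.pderiv i f := by
  simp [dirDeriv]

lemma pairing_linPoly_mul (u : Fin r → ℝ) (p f : MvPolynomial (Fin r) ℝ) :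
    pairing (linPoly u * p) f = pairing p (dirDeriv u f) := by
  let L : MvPolynomial (Fin r) ℝ →ₗ[ℝ] ℝ :=
    { toFun := fun q => pairing q f
      map_add' := fun q q' => pairing_add_left q q' f
      map_smul' := fun c q => pairing_smul_left c q f }
  let R : MvPolynomial (Fin r) ℝ →ₗ[ℝ] ℝ :=
    { toFun := pairing p
      map_add' := pairing_add p
      map_smul' := pairing_smul p }
  change L (linPoly u * p) = R (dirDeriv u f)
  rw [dirDeriv_apply, linPoly, Finset.sum_mul, map_sum, map_sum]
  refine Finset.sum_congr rfl fun i _ => ?_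
  rw [mul_assoc, ← MvPolynomial.smul_eq_C_mul, map_smul, map_smul]
  exact congrArg _ (pairing_X_mul i p f)

lemma pairing_linPoly_pow_mul (u : Fin r → ℝ) (m : ℕ) (p f : MvPolynomial (Fin r) ℝ) :
    pairing (linPoly u ^ m * p) f = pairing p ((dirDeriv u)^[m] f) := by
  induction m generalizing f with
  | zero => simp
  | succ m ih => rw [pow_succ', mul_assoc, pairing_linPoly_mul, ih, Function.iterate_succ_apply]

lemma derivative_lineRestrict (w η : Fin r → ℝ) (f : MvPolynomial (Fin r) ℝ) :
    Polynomial.derivative (lineRestrict w η f) = lineRestrict w η (dirDeriv η f) := by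
  induction f using MvPolynomial.induction_on with
  | C a => simp [lineRestrict, dirDeriv_apply]
  | add p q hp hq => simp only [map_add, hp, hq]
  | mul_X p i hp =>
    have hmul : dirDeriv η (p * MvPolynomial.X i) =
        dirDeriv η p * MvPolynomial.X i + MvPolynomial.C (η i) * p := by
      simp only [dirDeriv_apply, MvPolynomial.pderiv_mul, smul_add, Finset.sum_add_distrib,
        Finset.sum_mul, smul_mul_assoc]
      congr 1
      rw [Finset.sum_eq_single i]
      · rw [MvPolynomial.pderiv_X_self, mul_one, MvPolynomial.smul_eq_C_mul]
      · intro j _ hj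
        rw [MvPolynomial.pderiv_X_of_ne hj.symm, mul_zero, smul_zero]
      · simp
    rw [map_mul, Polynomial.derivative_mul, hp, hmul, map_add, map_mul, map_mul]
    have hX : lineRestrict w η (MvPolynomial.X i) =
        Polynomial.C (w i) + Polynomial.C (η i) * Polynomial.X := MvPolynomial.aeval_X _ i
    have hC : lineRestrict w η (MvPolynomial.C (η i)) = Polynomial.C (η i) :=
      MvPolynomial.algHom_C _ _
    rw [hX, hC, Polynomial.derivative_add, Polynomial.derivative_C, Polynomial.derivative_C_mul,
      Polynomial.derivative_X]
    ring

lemma iterate_derivative_lineRestrict (w η : Fin r → ℝ) (m : ℕ) (f : MvPolynomial (Fin r) ℝ) :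
    Polynomial.derivative^[m] (lineRestrict w η f) = lineRestrict w η ((dirDeriv η)^[m] f) := by
  induction m generalizing f with
  | zero => rfl
  | succ m ih => rw [Function.iterate_succ_apply, derivative_lineRestrict, ih,
      Function.iterate_succ_apply]

lemma iterate_dirDeriv_eq_zero_iff (η : Fin r → ℝ) (m : ℕ) (f : MvPolynomial (Fin r) ℝ) :
    (dirDeriv η)^[m] f = 0 ↔ ∀ w, (lineRestrict w η f).degree < m := by
  constructor
  · intro h w
    rw [Polynomial.degree_lt_iff_coeff_zero]
    intro k hk
    have hcoeff := Polynomial.coeff_iterate_derivative (k := m) (lineRestrict w η f) (k - m)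
    rw [iterate_derivative_lineRestrict, h, map_zero, Polynomial.coeff_zero,
      Nat.sub_add_cancel hk] at hcoeff
    refine (smul_eq_zero.1 hcoeff.symm).resolve_left ?_
    rw [Nat.descFactorial_eq_zero_iff_lt]
    omega
  · intro h
    refine MvPolynomial.funext fun w => ?_
    have := eval_lineRestrict w η ((dirDeriv η)^[m] f) 0
    rw [← iterate_derivative_lineRestrict,
      Polynomial.iterate_derivative_eq_zero_of_degree_lt (h w)] at this
    simpa using this.symm

lemma mem_kerIdeal_span_iff (s : Set (MvPolynomial (Fin r) ℝ)) (f : MvPolynomial (Fin r) ℝ) :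
    f ∈ kerIdeal (Ideal.span s) ↔ ∀ q ∈ s, ∀ p, pairing (q * p) f = 0 := by
  constructor
  · intro h q hq p
    exact h _ (Ideal.mul_mem_right p _ (Ideal.subset_span hq))
  · intro h q hq
    suffices ∀ p, pairing (q * p) f = 0 by simpa using this 1
    refine Submodule.span_induction (p := fun q _ => ∀ p, pairing (q * p) f = 0) h ?_ ?_ ?_ hq
    · intro p
      rw [zero_mul, pairing_comm, pairing_zero]
    · intro x y _ _ hx hy p
      rw [add_mul, pairing_add_left, hx, hy, add_zero]
    · intro a x _ hx p
      rw [smul_eq_mul, mul_comm a x, mul_assoc]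
      exact hx _

lemma mem_kerIdeal_span_linPoly_pow_iff (m : (Fin r → ℝ) → ℕ) (f : MvPolynomial (Fin r) ℝ) :
    f ∈ kerIdeal (Ideal.span {q | ∃ η : Fin r → ℝ, η ≠ 0 ∧ q = linPoly η ^ m η}) ↔
      ∀ η, η ≠ 0 → ∀ w, (lineRestrict w η f).degree < m η := by
  rw [mem_kerIdeal_span_iff]
  constructor
  · intro h η hη
    rw [← iterate_dirDeriv_eq_zero_iff]
    refine eq_zero_of_forall_pairing_eq_zero fun p => ?_
    rw [← pairing_linPoly_pow_mul]
    exact h _ ⟨η, hη, rfl⟩ p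
  · rintro h _ ⟨η, hη, rfl⟩ p
    rw [pairing_linPoly_pow_mul, (iterate_dirDeriv_eq_zero_iff η _ f).2 (h η hη), pairing_zero]

end Pairing

lemma PspaceOn_eq_separatingSpan {r N : ℕ} (X : Fin N → Fin r → ℝ) (G : Finset (Fin N)) :
    PspaceOn X G = separatingSpan X G ⊤ := by
  simp only [PspaceOn, separatingSpan, separates_top_iff]

lemma ncard_eq_directionOrder {r N : ℕ} (X : Fin N → Fin r → ℝ) (η : Fin r → ℝ) :
    Set.ncard {i : Fin N | (∑ j, η j * X i j) ≠ 0} = directionOrder X Finset.univ η := by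
  rw [directionOrder, ← Set.ncard_coe_finset]
  refine congrArg Set.ncard (Set.ext fun i => ?_)
  rw [Set.mem_ofPred_eq, Finset.mem_coe, Finset.mem_filter, dotProduct_comm]
  exact (and_iff_right (Finset.mem_univ i)).symm

/-- `𝒫(X) = ker ℐ(X)` where `ℐ(X)` is generated by the powers
`p_η^{m(η)}` for `η ≠ 0`, `m(η) = #{x ∈ X : η·x ≠ 0}`. -/
theorem statement1 {r N : ℕ} (X : Fin N → Fin r → ℝ)
    (hX : Submodule.span ℝ (Set.range X) = ⊤) :
    PspaceOn X Finset.univ =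
      kerIdeal (Ideal.span {q : MvPolynomial (Fin r) ℝ | ∃ η : Fin r → ℝ, η ≠ 0 ∧
        q = linPoly η ^ Set.ncard {i : Fin N | (∑ j, η j * X i j) ≠ 0}}) := by
  ext f
  rw [mem_kerIdeal_span_linPoly_pow_iff, PspaceOn_eq_separatingSpan]
  simp only [ncard_eq_directionOrder]
  constructor
  · intro hf η hη w
    exact degree_lineRestrict_lt_of_mem_separatingSpan hf Submodule.mem_top hη w
  · intro hf
    have hsep : Separates X Finset.univ ⊤ := by
      rwa [separates_top_iff, Finset.coe_univ, Set.image_univ]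
    obtain ⟨g, hg, hfg⟩ := exists_mem_separatingSpan_eval_eq Finset.univ ⊤ hsep f
      fun η _ hη w _ => hf η hη w
    rwa [MvPolynomial.funext fun w => hfg w Submodule.mem_top]
end

section
/- For every k ≥ 0, the dimension of the degree-k homogeneous component of 𝒫(X) equals the dimension of the degree-k homogeneous component of 𝒟(X), and both equal the number of bases B ∈ 𝔅(X) with |E(B)| = N − r − k. In particular dim 𝒫(X) = dim 𝒟(X) = |𝔅(X)|. -/
namespace DahmenMicchelli

open MvPolynomial Submodule

section Bases

variable {r N : ℕ} {X : Fin N → Fin r → ℝ}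

lemma mem_basesOn_iff {B : Finset (Fin N)} :
    B ∈ basesOn X Finset.univ ↔ B.card = r ∧ span ℝ (X '' (B : Set (Fin N))) = ⊤ := by
  have hrange : Set.range ((B : Set (Fin N)).restrict X) = X '' (B : Set (Fin N)) :=
    Set.range_domRestrict X _
  constructor
  · rintro ⟨-, hli, hsp⟩
    refine ⟨?_, hsp⟩
    have h := finrank_span_eq_card hli
    rw [hrange, hsp, finrank_top, Module.finrank_fin_fun] at h
    rw [h]
    exact (Fintype.card_coe B).symm
  · rintro ⟨hc, hsp⟩
    refine ⟨Finset.subset_univ _, ?_, hsp⟩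
    refine linearIndependent_of_top_le_span_of_card_eq_finrank (by rw [hrange, hsp]) ?_
    rw [Module.finrank_fin_fun]
    exact (Fintype.card_coe B).trans hc

lemma exists_basis_subset {Z : Finset (Fin N)} (hZ : span ℝ (X '' (Z : Set (Fin N))) = ⊤) :
    ∃ B ∈ basesOn X Finset.univ, B ⊆ Z := by
  classical
  obtain ⟨b, hbZ, -, hb, hli⟩ :=
    exists_linearIndepOn_extension (K := ℝ) (v := X) (linearIndepOn_empty ℝ X)
      (Set.empty_subset (Z : Set (Fin N)))
  have hbf : ((b.toFinset : Finset (Fin N)) : Set (Fin N)) = b := Set.coe_toFinset b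
  refine ⟨b.toFinset, ⟨Finset.subset_univ _, ?_, ?_⟩, ?_⟩
  · rw [hbf]; exact hli
  · rw [hbf, eq_top_iff, ← hZ]
    exact span_le.2 hb
  · rw [← Finset.coe_subset, hbf]; exact hbZ

lemma exists_coeff_of_mem_span {s : Finset (Fin N)} {x : Fin r → ℝ}
    (hx : x ∈ span ℝ (X '' (s : Set (Fin N)))) : ∃ a : Fin N → ℝ, x = ∑ i ∈ s, a i • X i := by
  obtain ⟨c, rfl⟩ := (mem_span_image_finset_iff_exists_fun ℝ).1 hx
  refine ⟨fun i => if h : i ∈ s then c ⟨i, h⟩ else 0, ?_⟩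
  rw [← Finset.sum_coe_sort s]
  exact Finset.sum_congr rfl fun i _ => by simp

/-- Replacing an element of a spanning list by a combination involving it keeps it spanning. -/
lemma span_exchange {Z s : Finset (Fin N)} (hZ : span ℝ (X '' (Z : Set (Fin N))) = ⊤)
    (hs : s ⊆ Z) {a : Fin N → ℝ} {e b : Fin N} (he : X e = ∑ i ∈ s, a i • X i)
    (hb : b ∈ s) (hab : a b ≠ 0) :
    span ℝ (X '' ((insert e (Z.erase b) : Finset (Fin N)) : Set (Fin N))) = ⊤ := by
  rw [eq_top_iff, ← hZ, span_le]
  rintro _ ⟨z, hz, rfl⟩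
  have hmem : ∀ i ∈ insert e (Z.erase b),
      X i ∈ span ℝ (X '' ((insert e (Z.erase b) : Finset (Fin N)) : Set (Fin N))) :=
    fun i hi => subset_span ⟨i, hi, rfl⟩
  by_cases hzb : z = b
  · subst hzb
    have h1 : a z • X z = X e - ∑ i ∈ s.erase z, a i • X i := by
      rw [he, ← Finset.add_sum_erase s _ hb]; abel
    have h2 : X z = (a z)⁻¹ • (X e - ∑ i ∈ s.erase z, a i • X i) := by
      rw [← h1, smul_smul, inv_mul_cancel₀ hab, one_smul]
    rw [SetLike.mem_coe, h2]
    refine smul_mem _ _ (sub_mem (hmem e (Finset.mem_insert_self _ _)) (sum_mem fun i hi => ?_))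
    exact smul_mem _ _ (hmem i (Finset.mem_insert_of_mem (Finset.erase_subset_erase z hs hi)))
  · exact hmem z (Finset.mem_insert_of_mem (Finset.mem_erase.2 ⟨hzb, hz⟩))

/-- A spanning list contains a basis for which all its other elements are externally active. -/
lemma exists_basis_subset_extActive {Z : Finset (Fin N)}
    (hZ : span ℝ (X '' (Z : Set (Fin N))) = ⊤) :
    ∃ B ∈ basesOn X Finset.univ, B ⊆ Z ∧ ∀ z ∈ Z, z ∉ B → isExtActive X B z := by
  classical
  have hne : (Finset.univ.filter fun B : Finset (Fin N) =>
      B ∈ basesOn X Finset.univ ∧ B ⊆ Z).Nonempty := by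
    obtain ⟨B, hB, hBZ⟩ := exists_basis_subset hZ
    exact ⟨B, by simp [hB, hBZ]⟩
  obtain ⟨B, hB, hmin⟩ := Finset.exists_min_image _ 
    (fun B : Finset (Fin N) => ∑ i ∈ B, (i : ℕ)) hne
  simp only [Finset.mem_filter, Finset.mem_univ, true_and] at hB hmin
  refine ⟨B, hB.1, hB.2, fun z hz hzB => ⟨hzB, ?_⟩⟩
  obtain ⟨hcard, hspan⟩ := mem_basesOn_iff.1 hB.1
  obtain ⟨a, ha⟩ := exists_coeff_of_mem_span (x := X z) (by rw [hspan]; exact mem_top)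
  rw [ha]
  refine sum_mem fun b hb => ?_
  by_cases hab : a b = 0
  · simp [hab]
  refine smul_mem _ _ (subset_span ⟨b, ⟨hb, ?_⟩, rfl⟩)
  by_contra! hlt
  have hzE : z ∉ B.erase b := fun h => hzB (Finset.mem_of_mem_erase h)
  have hB' : insert z (B.erase b) ∈ basesOn X Finset.univ := by
    refine mem_basesOn_iff.2 ⟨?_, span_exchange hspan subset_rfl ha hb hab⟩
    rw [Finset.card_insert_of_notMem hzE, Finset.card_erase_add_one hb, hcard]
  have hle := hmin _ ⟨hB', Finset.insert_subset hz ((Finset.erase_subset _ _).trans hB.2)⟩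
  rw [Finset.sum_insert hzE, ← Finset.add_sum_erase B _ hb] at hle
  have : (z : ℕ) < b := hlt
  omega

lemma exists_cocircuit_subset {Y : Finset (Fin N)}
    (hY : ∀ B ∈ basesOn X Finset.univ, (Y ∩ B).Nonempty) :
    ∃ C ⊆ Y, isCocircuitOn Finset.univ (basesOn X Finset.univ) C := by
  obtain ⟨C, hCY, hC⟩ := Set.Finite.exists_le_minimal
    (Set.toFinite {C : Finset (Fin N) | ∀ B ∈ basesOn X Finset.univ, (C ∩ B).Nonempty}) hY
  exact ⟨C, hCY, Finset.subset_univ _, hC.prop, fun C' hC' h => (hC.eq_of_le h hC')⟩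

lemma inter_basis_nonempty {Y : Finset (Fin N)}
    (hY : span ℝ (X '' ((Finset.univ \ Y : Finset (Fin N)) : Set (Fin N))) ≠ ⊤) :
    ∀ B ∈ basesOn X Finset.univ, (Y ∩ B).Nonempty := by
  intro B hB
  by_contra h
  rw [Finset.not_nonempty_iff_eq_empty, ← Finset.disjoint_iff_inter_eq_empty] at h
  refine hY (eq_top_iff.2 ?_)
  rw [← hB.2.2]
  refine span_mono (Set.image_mono ?_)
  rw [Finset.coe_subset]
  intro b hb
  simpa using Finset.disjoint_right.1 h hb

/-- A generic translation of the hyperplanes `X j` gives a simple arrangement; `θ B` is the vertex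
belonging to the basis `B`. -/
lemma exists_simple_arrangement (X : Fin N → Fin r → ℝ) :
    ∃ (c : Fin N → ℝ) (θ : Finset (Fin N) → Fin r → ℝ),
      ∀ B ∈ basesOn X Finset.univ, ∀ j, ∑ i, X j i * θ B i = c j ↔ j ∈ B := by
  classical
  have hT : ∀ B : Finset (Fin N), ∃ T : (Fin N → ℝ) →ₗ[ℝ] (Fin r → ℝ) →ₗ[ℝ] ℝ,
      B ∈ basesOn X Finset.univ → (∀ c, ∀ b ∈ B, T c (X b) = c b) ∧
        ∀ j ∉ B, T (Pi.single j 1) = 0 := by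
    intro B
    by_cases hB : B ∈ basesOn X Finset.univ
    · let β : Module.Basis (B : Set (Fin N)) ℝ (Fin r → ℝ) := Module.Basis.mk hB.2.1
        (hB.2.2.ge.trans_eq (congrArg _ (Set.range_domRestrict X _).symm))
      refine ⟨(β.constr ℝ).toLinearMap ∘ₗ
        LinearMap.funLeft ℝ ℝ (fun b : (B : Set (Fin N)) => (b : Fin N)), fun _ => ⟨?_, ?_⟩⟩
      · intro c b hb
        have hβ : X b = β ⟨b, hb⟩ := by simp [β]; rfl
        rw [hβ]
        simp [LinearMap.funLeft]
      · intro j hj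
        have h0 : LinearMap.funLeft ℝ ℝ (fun b : (B : Set (Fin N)) => (b : Fin N))
            (Pi.single j 1) = 0 := by
          ext ⟨i, hi⟩
          have : i ≠ j := fun h => hj (h ▸ hi)
          simp [LinearMap.funLeft, this]
        exact (congrArg (β.constr ℝ) h0).trans (map_zero _)
    · exact ⟨0, fun h => absurd h hB⟩
  choose T hT using hT
  obtain ⟨c, hc⟩ := Module.Dual.exists_forall_ne_zero_of_forall_exists
    (fun p : {p : Finset (Fin N) × Fin N // p.1 ∈ basesOn X Finset.univ ∧ p.2 ∉ p.1} =>
      (LinearMap.proj p.1.2 - (LinearMap.applyₗ (X p.1.2)) ∘ₗ T p.1.1 : (Fin N → ℝ) →ₗ[ℝ] ℝ))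
    (fun p => ⟨Pi.single p.1.2 1, by simp [(hT _ p.2.1).2 _ p.2.2]⟩)
  refine ⟨c, fun B i => T B c (Pi.single i 1), fun B hB j => ?_⟩
  have hsum : ∑ i, X j i * T B c (Pi.single i 1) = T B c (X j) := by
    conv_rhs => rw [← Finset.univ_sum_single (X j), map_sum]
    refine Finset.sum_congr rfl fun i _ => ?_
    rw [← smul_eq_mul, ← map_smul, ← Pi.single_smul, smul_eq_mul, mul_one]
  rw [hsum]
  refine ⟨fun h => ?_, fun h => (hT B hB).1 c j h⟩
  by_contra hj
  refine hc ⟨(B, j), hB, hj⟩ ?_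
  simp [h]

end Bases

section Polynomials

variable {r N : ℕ} (X : Fin N → Fin r → ℝ)

lemma linPoly_sum_smul {ι : Type*} (s : Finset ι) (a : ι → ℝ) (v : ι → Fin r → ℝ) :
    linPoly (∑ i ∈ s, a i • v i) = ∑ i ∈ s, a i • linPoly (v i) := by
  simp only [linPoly, Finset.sum_apply, Pi.smul_apply, smul_eq_mul, map_sum, map_mul,
    Finset.sum_mul, Finset.smul_sum, MvPolynomial.smul_eq_C_mul, mul_assoc]
  exact Finset.sum_comm

lemma linPoly_single (i : Fin r) : linPoly (Pi.single i 1) = MvPolynomial.X i := by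
  rw [linPoly, Finset.sum_eq_single i] <;> simp +contextual

lemma linPoly_isHomogeneous (u : Fin r → ℝ) : (linPoly u).IsHomogeneous 1 :=
  IsHomogeneous.sum _ _ _ fun i _ => isHomogeneous_C_mul_X (u i) i

lemma prodPoly_isHomogeneous (Y : Finset (Fin N)) : (prodPoly X Y).IsHomogeneous Y.card := by
  simpa [prodPoly] using IsHomogeneous.prod Y _ _ fun i _ => linPoly_isHomogeneous (X i)

/-- The degree of `Q_B`. -/
noncomputable def degQ (B : Finset (Fin N)) : ℕ :=
  (Finset.univ \ (B ∪ extSetOn X Finset.univ B)).card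

lemma QB_isHomogeneous (B : Finset (Fin N)) : (QB X Finset.univ B).IsHomogeneous (degQ X B) :=
  prodPoly_isHomogeneous X _

variable {X} in
lemma card_extSetOn_eq_iff {B : Finset (Fin N)} (hB : B ∈ basesOn X Finset.univ) (k : ℕ) :
    ((extSetOn X Finset.univ B).card : ℤ) = (N : ℤ) - r - k ↔ degQ X B = k := by
  have hdisj : Disjoint B (extSetOn X Finset.univ B) :=
    Finset.disjoint_left.2 fun b hb h => by
      simp only [extSetOn, Finset.mem_filter] at h
      exact h.2.1 hb
  have h1 := Finset.card_sdiff_add_card_eq_card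
    (Finset.subset_univ (B ∪ extSetOn X Finset.univ B))
  rw [Finset.card_union_of_disjoint hdisj, (mem_basesOn_iff.1 hB).1, Finset.card_univ,
    Fintype.card_fin] at h1
  unfold degQ
  omega

/-- The span of the `Q_B` of degree `k`. -/
noncomputable def Qspan (k : ℕ) : Submodule ℝ (MvPolynomial (Fin r) ℝ) :=
  span ℝ ((fun B : basesOn X Finset.univ => QB X Finset.univ B) '' {B | degQ X B = k})

/-- The degree `k` part of the cocircuit ideal. -/
noncomputable def Jpart (k : ℕ) : Submodule ℝ (MvPolynomial (Fin r) ℝ) :=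
  span ℝ {p | ∃ (C : Finset (Fin N)) (i : ℕ) (h : MvPolynomial (Fin r) ℝ),
    isCocircuitOn Finset.univ (basesOn X Finset.univ) C ∧ h.IsHomogeneous i ∧ i + C.card = k ∧
      p = h * prodPoly X C}

lemma Jpart_le_Jideal (k : ℕ) :
    Jpart X k ≤ (Jideal X Finset.univ (basesOn X Finset.univ)).restrictScalars ℝ := by
  rw [Jpart, span_le]
  rintro _ ⟨C, i, h, hC, -, -, rfl⟩
  exact Ideal.mul_mem_left _ _ (Ideal.subset_span ⟨C, hC, rfl⟩)

lemma homogeneousComponent_mem_Jpart {f : MvPolynomial (Fin r) ℝ}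
    (hf : f ∈ Jideal X Finset.univ (basesOn X Finset.univ)) (k : ℕ) :
    homogeneousComponent k f ∈ Jpart X k := by
  refine Submodule.closure_induction (p := fun f _ => homogeneousComponent k f ∈ Jpart X k)
    ?_ ?_ ?_ hf
  · simp
  · intro f g _ _ hf hg
    rw [map_add]
    exact add_mem hf hg
  · rintro h _ ⟨C, hC, rfl⟩
    rw [smul_eq_mul, ← sum_homogeneousComponent h, Finset.sum_mul, map_sum]
    refine sum_mem fun i _ => ?_
    have hi := homogeneousComponent_isHomogeneous i h
    rw [homogeneousComponent_of_mem (n := i + C.card) (hi.mul (prodPoly_isHomogeneous X C))]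
    split_ifs with hk
    · exact subset_span ⟨C, i, _, hC, hi, hk.symm, rfl⟩
    · exact zero_mem _

variable {X}

lemma prodPoly_mem_Qspan {Y : Finset (Fin N)}
    (hY : span ℝ (X '' ((Finset.univ \ Y : Finset (Fin N)) : Set (Fin N))) = ⊤) :
    prodPoly X Y ∈ Qspan X Y.card := by
  induction hn : ∑ i ∈ Y, (i : ℕ) using Nat.strong_induction_on generalizing Y with
  | _ n ih =>
  obtain ⟨B, hB, hBY, hact⟩ := exists_basis_subset_extActive hY
  by_cases hE : Disjoint Y (extSetOn X Finset.univ B)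
  · have hYeq : Y = Finset.univ \ (B ∪ extSetOn X Finset.univ B) := by
      ext i
      simp only [Finset.mem_sdiff, Finset.mem_univ, true_and, Finset.mem_union, not_or]
      refine ⟨fun hi => ⟨fun hb => (Finset.mem_sdiff.1 (hBY hb)).2 hi,
        Finset.disjoint_left.1 hE hi⟩, fun ⟨h1, h2⟩ => ?_⟩
      by_contra hi
      refine h2 ?_
      simp only [extSetOn, Finset.mem_filter, Finset.mem_univ, true_and]
      exact hact i (by simp [hi]) h1
    refine subset_span ⟨⟨B, hB⟩, ?_, ?_⟩
    · simp only [Set.mem_ofPred_eq, degQ, ← hYeq]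
    · simp only [QB, ← hYeq]
  · obtain ⟨e, heY, heE⟩ := Finset.not_disjoint_iff.1 hE
    simp only [extSetOn, Finset.mem_filter, Finset.mem_univ, true_and] at heE
    obtain ⟨heB, he⟩ := heE
    obtain ⟨a, ha⟩ := exists_coeff_of_mem_span (s := B.filter (· ≤ e)) (x := X e)
      (by simpa using he)
    have hsplit : prodPoly X Y =
        ∑ b ∈ B.filter (· ≤ e), a b • prodPoly X (insert b (Y.erase e)) := by
      rw [prodPoly, ← Finset.mul_prod_erase Y _ heY, ha, linPoly_sum_smul, Finset.sum_mul]
      refine Finset.sum_congr rfl fun b hb => ?_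
      have hbY : b ∉ Y.erase e := fun h => (Finset.mem_sdiff.1
        (hBY (Finset.mem_filter.1 hb).1)).2 (Finset.mem_of_mem_erase h)
      rw [prodPoly, Finset.prod_insert hbY, smul_mul_assoc]
    rw [hsplit]
    refine sum_mem fun b hb => ?_
    by_cases hab : a b = 0
    · simp [hab]
    refine smul_mem _ _ ?_
    obtain ⟨hbB, hbe⟩ := Finset.mem_filter.1 hb
    have hbY : b ∉ Y := (Finset.mem_sdiff.1 (hBY hbB)).2
    have hbY' : b ∉ Y.erase e := fun h => hbY (Finset.mem_of_mem_erase h)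
    have hcard : (insert b (Y.erase e)).card = Y.card := by
      rw [Finset.card_insert_of_notMem hbY', Finset.card_erase_add_one heY]
    rw [← hcard]
    refine ih _ ?_ ?_ rfl
    · have hlt : (b : ℕ) < e := lt_of_le_of_ne hbe fun h => hbY (by rwa [Fin.ext h])
      rw [← hn, Finset.sum_insert hbY', ← Finset.add_sum_erase Y _ heY]
      omega
    · have hset : Finset.univ \ insert b (Y.erase e) = insert e ((Finset.univ \ Y).erase b) := by
        ext i
        by_cases hie : i = e
        · subst hie
          have : i ≠ b := fun h => hbY (h ▸ heY)
          simp [this]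
        · simp [hie]
      rw [hset]
      exact span_exchange hY ((Finset.filter_subset _ _).trans hBY) ha hb hab

lemma linPoly_mul_prodPoly_mem {Y : Finset (Fin N)}
    (hY : span ℝ (X '' ((Finset.univ \ Y : Finset (Fin N)) : Set (Fin N))) = ⊤) (u : Fin r → ℝ) :
    linPoly u * prodPoly X Y ∈ Qspan X (Y.card + 1) ⊔ Jpart X (Y.card + 1) := by
  obtain ⟨a, rfl⟩ := exists_coeff_of_mem_span (x := u) (by rw [hY]; exact mem_top)
  rw [linPoly_sum_smul, Finset.sum_mul]
  refine sum_mem fun i hi => ?_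
  have hiY : i ∉ Y := (Finset.mem_sdiff.1 hi).2
  rw [smul_mul_assoc]
  refine smul_mem _ _ ?_
  have hprod : linPoly (X i) * prodPoly X Y = prodPoly X (insert i Y) := by
    rw [prodPoly, prodPoly, Finset.prod_insert hiY]
  rw [hprod, ← Finset.card_insert_of_notMem hiY]
  by_cases hs : span ℝ (X '' ((Finset.univ \ insert i Y : Finset (Fin N)) : Set (Fin N))) = ⊤
  · exact mem_sup_left (prodPoly_mem_Qspan hs)
  · obtain ⟨C, hCY, hC⟩ := exists_cocircuit_subset (inter_basis_nonempty hs)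
    refine mem_sup_right (subset_span ⟨C, _, _, hC, prodPoly_isHomogeneous X (insert i Y \ C),
      Finset.card_sdiff_add_card_eq_card hCY, ?_⟩)
    rw [prodPoly, prodPoly, prodPoly, Finset.prod_sdiff hCY]

lemma compl_QB_spans {B : Finset (Fin N)} (hB : B ∈ basesOn X Finset.univ) :
    span ℝ (X '' ((Finset.univ \ (Finset.univ \ (B ∪ extSetOn X Finset.univ B)) :
      Finset (Fin N)) : Set (Fin N))) = ⊤ := by
  rw [eq_top_iff, ← hB.2.2]
  refine span_mono (Set.image_mono ?_)
  rw [Finset.coe_subset, Finset.sdiff_sdiff_eq_self (Finset.subset_univ _)]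
  exact Finset.subset_union_left

lemma homogeneousSubmodule_le (hX : span ℝ (Set.range X) = ⊤) (k : ℕ) :
    homogeneousSubmodule (Fin r) ℝ k ≤ Qspan X k ⊔ Jpart X k := by
  induction k with
  | zero =>
    rw [homogeneousSubmodule_zero, Submodule.one_le]
    refine mem_sup_left ?_
    simpa [prodPoly] using prodPoly_mem_Qspan (X := X) (Y := ∅) (by simpa using hX)
  | succ k ih =>
    rw [← homogeneousSubmodule_one_pow, pow_succ', homogeneousSubmodule_one_pow,
      homogeneousSubmodule_one_eq_span_X]
    refine (mul_le_mul_right ih _).trans ?_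
    rw [Submodule.mul_sup, Qspan, Jpart, Submodule.span_mul_span, Submodule.span_mul_span]
    refine sup_le (span_le.2 ?_) (span_le.2 ?_)
    · rintro _ ⟨_, ⟨i, rfl⟩, _, ⟨⟨B, hB⟩, rfl, rfl⟩, rfl⟩
      have := linPoly_mul_prodPoly_mem (compl_QB_spans hB) (Pi.single i 1)
      rwa [linPoly_single] at this
    · rintro _ ⟨_, ⟨i, rfl⟩, _, ⟨C, j, h, hC, hh, rfl, rfl⟩, rfl⟩
      refine mem_sup_right (subset_span ⟨C, 1 + j, _, hC, (isHomogeneous_X ℝ i).mul hh, ?_, ?_⟩)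
      · ring
      · exact (mul_assoc _ _ _).symm

lemma PspaceOn_eq_span :
    PspaceOn X Finset.univ =
      span ℝ (Set.range fun B : basesOn X Finset.univ => QB X Finset.univ B) := by
  apply le_antisymm
  · rw [PspaceOn, span_le]
    rintro _ ⟨Y, -, hY, rfl⟩
    exact span_mono (Set.image_subset_range _ _) (prodPoly_mem_Qspan hY)
  · rw [span_le]
    rintro _ ⟨⟨B, hB⟩, rfl⟩
    exact subset_span ⟨_, Finset.subset_univ _, compl_QB_spans hB, rfl⟩

end Polynomials

section Evaluation

variable {r N : ℕ} {X : Fin N → Fin r → ℝ}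

/-- The polynomials of degree less than `k`. -/
noncomputable def lowDegree (r k : ℕ) : Submodule ℝ (MvPolynomial (Fin r) ℝ) :=
  ⨆ (i : ℕ) (_ : i < k), homogeneousSubmodule (Fin r) ℝ i

lemma homogeneousSubmodule_le_lowDegree {i k : ℕ} (h : i < k) :
    homogeneousSubmodule (Fin r) ℝ i ≤ lowDegree r k :=
  le_iSup₂_of_le i h le_rfl

lemma lowDegree_mono {k l : ℕ} (h : k ≤ l) : lowDegree r k ≤ lowDegree r l :=
  iSup₂_le fun _ hi => homogeneousSubmodule_le_lowDegree (hi.trans_le h)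

lemma lowDegree_succ_le (k : ℕ) :
    lowDegree r (k + 1) ≤ lowDegree r k ⊔ homogeneousSubmodule (Fin r) ℝ k := by
  refine iSup₂_le fun i hi => ?_
  rcases (Nat.lt_succ_iff.1 hi).lt_or_eq with h | rfl
  · exact le_sup_of_le_left (homogeneousSubmodule_le_lowDegree h)
  · exact le_sup_right

lemma mem_lowDegree (f : MvPolynomial (Fin r) ℝ) : f ∈ lowDegree r (f.totalDegree + 1) := by
  nth_rewrite 2 [← sum_homogeneousComponent f]
  exact sum_mem fun i hi => homogeneousSubmodule_le_lowDegree (Finset.mem_range.1 hi)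
    (homogeneousComponent_isHomogeneous i f)

lemma mul_mem_lowDegree {i k : ℕ} {p q : MvPolynomial (Fin r) ℝ} (hp : p.IsHomogeneous i)
    (hq : q ∈ lowDegree r k) : p * q ∈ lowDegree r (i + k) := by
  have : lowDegree r k ≤ (lowDegree r (i + k)).comap (LinearMap.mulLeft ℝ p) :=
    iSup₂_le fun j hj x hx =>
      homogeneousSubmodule_le_lowDegree (Nat.add_lt_add_left hj i) (hp.mul hx)
  exact this hq

/-- Shifting the linear factors by constants changes a product only in lower degrees. -/
lemma prodPoly_sub_shift_mem (c : Fin N → ℝ) (Y : Finset (Fin N)) :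
    prodPoly X Y - ∏ i ∈ Y, (linPoly (X i) - C (c i)) ∈ lowDegree r Y.card := by
  induction Y using Finset.induction_on with
  | empty => simp [prodPoly]
  | insert a s ha ih =>
    have hsplit : prodPoly X (insert a s) - ∏ i ∈ insert a s, (linPoly (X i) - C (c i)) =
        linPoly (X a) * (prodPoly X s - ∏ i ∈ s, (linPoly (X i) - C (c i))) +
          (c a • prodPoly X s -
            c a • (prodPoly X s - ∏ i ∈ s, (linPoly (X i) - C (c i)))) := by
      rw [Finset.prod_insert ha, prodPoly, Finset.prod_insert ha, ← prodPoly, smul_eq_C_mul,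
        smul_eq_C_mul]
      ring
    rw [hsplit, Finset.card_insert_of_notMem ha]
    refine add_mem ?_ (sub_mem (smul_mem _ _ ?_) (smul_mem _ _ ?_))
    · rw [add_comm s.card]
      exact mul_mem_lowDegree (linPoly_isHomogeneous _) ih
    · exact homogeneousSubmodule_le_lowDegree (Nat.lt_succ_self _) (prodPoly_isHomogeneous X s)
    · exact lowDegree_mono (Nat.le_succ _) ih

/-- Simultaneous evaluation at the points `θ B`, where `B` runs through the bases. -/
noncomputable def evalBases (X : Fin N → Fin r → ℝ) (θ : Finset (Fin N) → Fin r → ℝ) :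
    MvPolynomial (Fin r) ℝ →ₐ[ℝ] (basesOn X Finset.univ → ℝ) :=
  AlgHom.pi fun B => aeval (θ B)

variable {c : Fin N → ℝ} {θ : Finset (Fin N) → Fin r → ℝ}

lemma evalBases_shift (Y : Finset (Fin N)) (B : basesOn X Finset.univ) :
    evalBases X θ (∏ i ∈ Y, (linPoly (X i) - C (c i))) B =
      ∏ i ∈ Y, (∑ l, X i l * θ B l - c i) := by
  simp [evalBases, linPoly, map_prod]

lemma evalBases_surjective
    (hθ : ∀ B ∈ basesOn X Finset.univ, ∀ j, ∑ i, X j i * θ B i = c j ↔ j ∈ B) :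
    Function.Surjective (evalBases X θ) := by
  classical
  intro w
  cases nonempty_fintype (basesOn X Finset.univ)
  let g (B : basesOn X Finset.univ) : MvPolynomial (Fin r) ℝ :=
    ∏ i ∈ Finset.univ \ B.1, (linPoly (X i) - C (c i))
  have hgB (B) : evalBases X θ (g B) B ≠ 0 := by
    rw [evalBases_shift, Finset.prod_ne_zero_iff]
    intro i hi h
    exact (Finset.mem_sdiff.1 hi).2 ((hθ B B.2 i).1 (sub_eq_zero.1 h))
  have hgne (B B') (h : B ≠ B') : evalBases X θ (g B) B' = 0 := by
    have hsub : ¬ B'.1 ⊆ B.1 := fun hs => h <| Subtype.ext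
      (Finset.eq_of_subset_of_card_le hs
        (((mem_basesOn_iff.1 B.2).1.trans (mem_basesOn_iff.1 B'.2).1.symm).le)).symm
    obtain ⟨i, hi', hi⟩ := Finset.not_subset.1 hsub
    rw [evalBases_shift]
    exact Finset.prod_eq_zero (i := i) (by simpa using hi) (sub_eq_zero.2 ((hθ B' B'.2 i).2 hi'))
  refine ⟨∑ B, (w B / evalBases X θ (g B) B) • g B, ?_⟩
  ext B'
  rw [map_sum, Finset.sum_apply, Finset.sum_eq_single B']
  · rw [map_smul, Pi.smul_apply, smul_eq_mul, div_mul_cancel₀ _ (hgB B')]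
  · intro B _ hB
    rw [map_smul, Pi.smul_apply, hgne B B' hB, smul_zero]
  · simp

lemma evalBases_mem_of_mem_Jpart
    (hθ : ∀ B ∈ basesOn X Finset.univ, ∀ j, ∑ i, X j i * θ B i = c j ↔ j ∈ B)
    {k : ℕ} {f : MvPolynomial (Fin r) ℝ} (hf : f ∈ Jpart X k) :
    evalBases X θ f ∈ (lowDegree r k).map (evalBases X θ).toLinearMap := by
  have : Jpart X k ≤ ((lowDegree r k).map (evalBases X θ).toLinearMap).comap
      (evalBases X θ).toLinearMap := by
    rw [Jpart, span_le]
    rintro _ ⟨C, i, h, hC, hh, rfl, rfl⟩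
    refine ⟨_, mul_mem_lowDegree hh (prodPoly_sub_shift_mem (X := X) c C), ?_⟩
    have h0 : evalBases X θ (∏ i ∈ C, (linPoly (X i) - MvPolynomial.C (c i))) = 0 := by
      ext B
      obtain ⟨i, hi⟩ := hC.2.1 B B.2
      rw [Finset.mem_inter] at hi
      rw [evalBases_shift]
      exact Finset.prod_eq_zero hi.1 (sub_eq_zero.2 ((hθ B B.2 i).2 hi.2))
    simp [map_sub, h0]
  exact this hf

lemma map_lowDegree_le
    (hθ : ∀ B ∈ basesOn X Finset.univ, ∀ j, ∑ i, X j i * θ B i = c j ↔ j ∈ B)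
    (hX : span ℝ (Set.range X) = ⊤) (k : ℕ) :
    (lowDegree r k).map (evalBases X θ).toLinearMap ≤
      span ℝ ((fun B : basesOn X Finset.univ => evalBases X θ (QB X Finset.univ B)) ''
        {B | degQ X B < k}) := by
  induction k with
  | zero => simp [lowDegree]
  | succ k ih =>
    have hsub : {B : basesOn X Finset.univ | degQ X B < k} ⊆ {B | degQ X B < k + 1} :=
      fun B hB => Nat.lt_succ_of_lt hB
    have ih' := ih.trans (span_mono (Set.image_mono hsub))
    refine (Submodule.map_mono ((lowDegree_succ_le k).trans
      (sup_le_sup_left (homogeneousSubmodule_le hX k) _))).trans ?_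
    rw [Submodule.map_sup, Submodule.map_sup]
    refine sup_le ih' (sup_le ?_ ?_)
    · rw [Qspan, Submodule.map_span, ← Set.image_comp]
      exact span_mono (Set.image_mono fun B hB => Nat.lt_succ_of_le (le_of_eq hB))
    · refine le_trans ?_ ih'
      rintro _ ⟨f, hf, rfl⟩
      exact evalBases_mem_of_mem_Jpart hθ hf

lemma linearIndependent_evalBases_QB
    (hθ : ∀ B ∈ basesOn X Finset.univ, ∀ j, ∑ i, X j i * θ B i = c j ↔ j ∈ B)
    (hX : span ℝ (Set.range X) = ⊤) :
    LinearIndependent ℝ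
      (fun B : basesOn X Finset.univ => evalBases X θ (QB X Finset.univ B)) := by
  cases nonempty_fintype (basesOn X Finset.univ)
  refine linearIndependent_of_top_le_span_of_card_eq_finrank ?_
    (Module.finrank_fintype_fun_eq_card ℝ).symm
  intro w _
  obtain ⟨f, rfl⟩ := evalBases_surjective hθ w
  exact span_mono (Set.image_subset_range _ _)
    (map_lowDegree_le hθ hX _ ⟨f, mem_lowDegree f, rfl⟩)

lemma linearIndependent_QB (hX : span ℝ (Set.range X) = ⊤) :
    LinearIndependent ℝ (fun B : basesOn X Finset.univ => QB X Finset.univ B) := by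
  obtain ⟨c, θ, hθ⟩ := exists_simple_arrangement X
  exact LinearIndependent.of_comp (evalBases X θ).toLinearMap
    (linearIndependent_evalBases_QB hθ hX)

lemma disjoint_Qspan_Jpart (hX : span ℝ (Set.range X) = ⊤) (k : ℕ) :
    Disjoint (Qspan X k) (Jpart X k) := by
  obtain ⟨c, θ, hθ⟩ := exists_simple_arrangement X
  have hli := linearIndependent_evalBases_QB hθ hX
  rw [Submodule.disjoint_def]
  intro f hfQ hfJ
  have h1 : evalBases X θ f ∈ span ℝ
      ((fun B : basesOn X Finset.univ => evalBases X θ (QB X Finset.univ B)) ''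
        {B | degQ X B = k}) := by
    have := Submodule.mem_map_of_mem (f := (evalBases X θ).toLinearMap) hfQ
    rwa [Qspan, Submodule.map_span, ← Set.image_comp] at this
  have h2 := map_lowDegree_le hθ hX k (evalBases_mem_of_mem_Jpart hθ hfJ)
  have h0 : evalBases X θ f = 0 := Submodule.disjoint_def.1
    (hli.disjoint_span_image (Set.disjoint_left.2 fun B hB hB' => hB'.ne hB)) _ h1 h2
  exact Submodule.disjoint_def.1 (Submodule.range_ker_disjoint
    (f := (evalBases X θ).toLinearMap) hli) f (span_mono (Set.image_subset_range _ _) hfQ) h0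

end Evaluation

section Duality

variable {r N : ℕ} {X : Fin N → Fin r → ℝ}

/-- The pairing as a linear functional of its first argument. -/
noncomputable def pairingLeft (f : MvPolynomial (Fin r) ℝ) : MvPolynomial (Fin r) ℝ →ₗ[ℝ] ℝ :=
  (basisMonomials (Fin r) ℝ).constr ℝ fun α => (∏ i, ((α i).factorial : ℝ)) * f.coeff α

lemma sum_support_eq_apply {M : Type*} [AddCommGroup M] [Module ℝ M]
    (φ : MvPolynomial (Fin r) ℝ →ₗ[ℝ] M) (q : MvPolynomial (Fin r) ℝ) :
    φ q = ∑ α ∈ q.support, q.coeff α • φ (monomial α 1) := by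
  nth_rewrite 1 [q.as_sum]
  rw [map_sum]
  exact Finset.sum_congr rfl fun α _ => by rw [← map_smul, smul_monomial, smul_eq_mul, mul_one]

lemma pairingLeft_monomial (f : MvPolynomial (Fin r) ℝ) (α : Fin r →₀ ℕ) :
    pairingLeft f (monomial α 1) = (∏ i, ((α i).factorial : ℝ)) * f.coeff α := by
  rw [← congrFun (coe_basisMonomials (Fin r) ℝ) α, pairingLeft, Module.Basis.constr_basis]

lemma pairingLeft_apply (q f : MvPolynomial (Fin r) ℝ) : pairingLeft f q = pairing q f := by
  rw [sum_support_eq_apply, pairing]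
  refine Finset.sum_congr rfl fun α _ => ?_
  rw [pairingLeft_monomial, smul_eq_mul]
  ring

lemma prod_factorial_ne_zero (α : Fin r →₀ ℕ) : ∏ i, ((α i).factorial : ℝ) ≠ 0 :=
  Finset.prod_ne_zero_iff.2 fun _ _ => Nat.cast_ne_zero.2 (Nat.factorial_ne_zero _)

lemma eq_zero_of_pairingLeft_eq_zero {f : MvPolynomial (Fin r) ℝ} (h : pairingLeft f = 0) :
    f = 0 := by
  ext α
  have := pairingLeft_monomial f α
  rw [h, LinearMap.zero_apply] at this
  simpa [prod_factorial_ne_zero] using this.symm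

/-- A functional concentrated in one degree is represented by a homogeneous polynomial. -/
lemma exists_pairingLeft_eq {k : ℕ} (φ : MvPolynomial (Fin r) ℝ →ₗ[ℝ] ℝ)
    (hφ : ∀ j ≠ k, ∀ f : MvPolynomial (Fin r) ℝ, f.IsHomogeneous j → φ f = 0) :
    ∃ f : MvPolynomial (Fin r) ℝ, f.IsHomogeneous k ∧ pairingLeft f = φ := by
  classical
  refine ⟨∑ α ∈ Finset.finsuppAntidiag Finset.univ k,
    monomial α ((∏ i, ((α i).factorial : ℝ))⁻¹ * φ (monomial α 1)), ?_, ?_⟩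
  · refine IsHomogeneous.sum _ _ _ fun α hα => isHomogeneous_monomial _ ?_
    rw [Finset.mem_finsuppAntidiag] at hα
    rw [Finsupp.degree_eq_sum]
    exact hα.1
  · refine (basisMonomials (Fin r) ℝ).ext fun α => ?_
    rw [congrFun (coe_basisMonomials (Fin r) ℝ) α, pairingLeft_monomial, coeff_sum]
    simp only [coeff_monomial, Finset.sum_ite_eq']
    split_ifs with hα
    · rw [mul_inv_cancel_left₀ (prod_factorial_ne_zero α)]
    · rw [mul_zero]
      refine (hφ α.degree (fun h => hα ?_) _ (isHomogeneous_monomial _ rfl)).symm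
      rw [Finset.mem_finsuppAntidiag]
      exact ⟨by rw [← h, Finsupp.degree_eq_sum], Finset.subset_univ _⟩

lemma isCompl_PspaceOn_Jideal (hX : span ℝ (Set.range X) = ⊤) :
    IsCompl (span ℝ (Set.range fun B : basesOn X Finset.univ => QB X Finset.univ B))
      ((Jideal X Finset.univ (basesOn X Finset.univ)).restrictScalars ℝ) := by
  constructor
  · rw [Submodule.disjoint_def]
    intro f hQ hJ
    have hcomp : ∀ k, homogeneousComponent k f ∈ Qspan X k := fun k => by
      have : span ℝ (Set.range fun B : basesOn X Finset.univ => QB X Finset.univ B) ≤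
          (Qspan X k).comap (homogeneousComponent k) := by
        rw [span_le]
        rintro _ ⟨B, rfl⟩
        rw [SetLike.mem_coe, Submodule.mem_comap,
          homogeneousComponent_of_mem (QB_isHomogeneous X B)]
        split_ifs with h
        · exact subset_span ⟨B, h.symm, rfl⟩
        · exact zero_mem _
      exact this hQ
    rw [← sum_homogeneousComponent f]
    exact Finset.sum_eq_zero fun k _ => Submodule.disjoint_def.1 (disjoint_Qspan_Jpart hX k) _
      (hcomp k) (homogeneousComponent_mem_Jpart X hJ k)
  · rw [codisjoint_iff, eq_top_iff]
    intro f _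
    rw [← sum_homogeneousComponent f]
    exact sum_mem fun k _ => sup_le_sup (span_mono (Set.image_subset_range _ _))
      (Jpart_le_Jideal X k) (homogeneousSubmodule_le hX k (homogeneousComponent_isHomogeneous k f))

/-- The functionals dual to the `Q_B` that vanish on the cocircuit ideal. -/
lemma exists_dual_functional (hX : span ℝ (Set.range X) = ⊤) (B : basesOn X Finset.univ) :
    ∃ φ : MvPolynomial (Fin r) ℝ →ₗ[ℝ] ℝ, φ (QB X Finset.univ B) = 1 ∧
      (∀ B' : basesOn X Finset.univ, B' ≠ B → φ (QB X Finset.univ B') = 0) ∧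
      ∀ f ∈ Jideal X Finset.univ (basesOn X Finset.univ), φ f = 0 := by
  classical
  have hc := isCompl_PspaceOn_Jideal hX
  let β := Module.Basis.span (linearIndependent_QB hX)
  have hβ (B' : basesOn X Finset.univ) :
      Submodule.projectionOnto _ _ hc (QB X Finset.univ B') = β B' := by
    have := Submodule.projectionOnto_apply_left hc (β B')
    rw [Module.Basis.span_apply] at this
    exact this.trans (Module.Basis.span_apply (linearIndependent_QB hX) B').symm
  refine ⟨β.coord B ∘ₗ Submodule.projectionOnto _ _ hc, ?_, fun B' h => ?_, fun f hf => ?_⟩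
  · rw [LinearMap.comp_apply, hβ]
    simp
  · rw [LinearMap.comp_apply, hβ]
    simp [h]
  · rw [LinearMap.comp_apply, (Submodule.projectionOnto_apply_eq_zero_iff hc).2 hf, map_zero]

/-- The Dahmen–Micchelli space has a homogeneous basis dual to the `Q_B`. -/
lemma exists_homogeneous_basis_Dspace (hX : span ℝ (Set.range X) = ⊤) :
    ∃ w : basesOn X Finset.univ → MvPolynomial (Fin r) ℝ, LinearIndependent ℝ w ∧
      (∀ B, (w B).IsHomogeneous (degQ X B)) ∧
      span ℝ (Set.range w) = Dspace X Finset.univ (basesOn X Finset.univ) := by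
  classical
  cases nonempty_fintype (basesOn X Finset.univ)
  choose φ hφ1 hφ0 hφJ using exists_dual_functional hX
  have hconc : ∀ B : basesOn X Finset.univ, ∀ j ≠ degQ X B, ∀ f : MvPolynomial (Fin r) ℝ,
      f.IsHomogeneous j → φ B f = 0 := by
    intro B j hj f hf
    have hle : Qspan X j ⊔ Jpart X j ≤ LinearMap.ker (φ B) := by
      refine sup_le (span_le.2 ?_) fun f hf => hφJ B f (Jpart_le_Jideal X j hf)
      rintro _ ⟨B', rfl, rfl⟩
      exact hφ0 B B' fun h => hj (h ▸ rfl)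
    exact hle (homogeneousSubmodule_le hX j hf)
  choose w hw hwφ using fun B => exists_pairingLeft_eq (φ B) (hconc B)
  have hdual (B B' : basesOn X Finset.univ) :
      pairingLeft (w B) (QB X Finset.univ B') = if B = B' then 1 else 0 := by
    rw [hwφ]
    split_ifs with h
    · rw [← h, hφ1]
    · exact hφ0 B B' (Ne.symm h)
  have hadd (q : MvPolynomial (Fin r) ℝ) (a : basesOn X Finset.univ → ℝ) :
      pairing q (∑ B, a B • w B) = ∑ B, a B * pairingLeft (w B) q := by
    let L : MvPolynomial (Fin r) ℝ →ₗ[ℝ] ℝ :=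
      { toFun := pairing q
        map_add' := pairing_add q
        map_smul' := pairing_smul q }
    change L _ = _
    rw [map_sum]
    refine Finset.sum_congr rfl fun B _ => ?_
    rw [map_smul, pairingLeft_apply]
    rfl
  refine ⟨w, ?_, hw, le_antisymm ?_ fun f hf => ?_⟩
  · rw [Fintype.linearIndependent_iff]
    intro a ha B
    have := hadd (QB X Finset.univ B) a
    rw [ha, pairing_zero] at this
    simpa [hdual] using this.symm
  · rw [span_le]
    rintro _ ⟨B, rfl⟩ q hq
    rw [← pairingLeft_apply, hwφ, hφJ B q hq]
  · let a (B : basesOn X Finset.univ) : ℝ := pairingLeft f (QB X Finset.univ B)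
    have hker : LinearMap.ker (pairingLeft f - ∑ B, a B • pairingLeft (w B)) = ⊤ := by
      rw [eq_top_iff, ← (isCompl_PspaceOn_Jideal hX).sup_eq_top]
      refine sup_le (span_le.2 ?_) fun q hq => ?_
      · rintro _ ⟨B, rfl⟩
        simp [hdual, a]
      · have h1 : pairingLeft f q = 0 := by rw [pairingLeft_apply]; exact hf q hq
        have h2 (B) : pairingLeft (w B) q = 0 := by rw [hwφ]; exact hφJ B q hq
        simp [h1, h2]
    have hzero : f - ∑ B, a B • w B = 0 := by
      refine eq_zero_of_pairingLeft_eq_zero (LinearMap.ext fun q => ?_)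
      have hq : pairingLeft f q = ∑ B, a B * pairingLeft (w B) q := by
        have hq : q ∈ LinearMap.ker (pairingLeft f - ∑ B, a B • pairingLeft (w B)) :=
          hker ▸ mem_top
        simpa [sub_eq_zero] using hq
      rw [LinearMap.zero_apply, pairingLeft_apply, sub_eq_add_neg, ← neg_one_smul ℝ, pairing_add,
        pairing_smul, hadd, ← hq, pairingLeft_apply]
      ring
    rw [sub_eq_zero.1 hzero]
    exact sum_mem fun B _ => smul_mem _ _ (subset_span ⟨B, rfl⟩)

lemma finrank_span_inf_homogeneousSubmodule {ι : Type*} [Finite ι]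
    {w : ι → MvPolynomial (Fin r) ℝ} (hw : LinearIndependent ℝ w) {d : ι → ℕ}
    (hd : ∀ i, (w i).IsHomogeneous (d i)) (k : ℕ) :
    Module.finrank ℝ ↥(span ℝ (Set.range w) ⊓ homogeneousSubmodule (Fin r) ℝ k) =
      Nat.card {i // d i = k} := by
  have : span ℝ (Set.range w) ⊓ homogeneousSubmodule (Fin r) ℝ k =
      span ℝ (Set.range fun i : {i // d i = k} => w i) := by
    apply le_antisymm
    · rintro f ⟨hf, hfk⟩
      have hle : span ℝ (Set.range w) ≤
          (span ℝ (Set.range fun i : {i // d i = k} => w i)).comap (homogeneousComponent k) := by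
        rw [span_le]
        rintro _ ⟨i, rfl⟩
        rw [SetLike.mem_coe, Submodule.mem_comap, homogeneousComponent_of_mem (hd i)]
        split_ifs with h
        · exact subset_span ⟨⟨i, h.symm⟩, rfl⟩
        · exact zero_mem _
      have := hle hf
      rwa [Submodule.mem_comap, homogeneousComponent_of_mem hfk, if_pos rfl] at this
    · rw [span_le]
      rintro _ ⟨⟨i, rfl⟩, rfl⟩
      exact ⟨subset_span ⟨i, rfl⟩, hd i⟩
  cases nonempty_fintype ι
  classical
  rw [this, Nat.card_eq_fintype_card]
  exact finrank_span_eq_card (hw.comp _ Subtype.val_injective)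

lemma card_degQ_eq_ncard (k : ℕ) :
    Nat.card {B : basesOn X Finset.univ // degQ X B = k} =
      Set.ncard {B ∈ basesOn X Finset.univ |
        ((extSetOn X Finset.univ B).card : ℤ) = (N : ℤ) - r - k} := by
  rw [← Nat.card_coe_set_eq]
  refine Nat.card_congr ((Equiv.subtypeSubtypeEquivSubtypeInter
    (fun B => B ∈ basesOn X Finset.univ) (fun B => degQ X B = k)).trans
    (Equiv.subtypeEquivRight fun B => and_congr_right fun hB => (card_extSetOn_eq_iff hB k).symm))

end Duality

end DahmenMicchelli

/-- Hilbert series of `𝒫(X)` and `𝒟(X)` agree and are counted by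
external activity; in particular both dimensions equal `|𝔅(X)|`. -/
theorem statement3 {r N : ℕ} (X : Fin N → Fin r → ℝ)
    (hX : Submodule.span ℝ (Set.range X) = ⊤) :
    (∀ k : ℕ,
      Module.finrank ℝ
          ↥(PspaceOn X Finset.univ ⊓ MvPolynomial.homogeneousSubmodule (Fin r) ℝ k)
        = Set.ncard {B ∈ basesOn X Finset.univ |
            ((extSetOn X Finset.univ B).card : ℤ) = (N : ℤ) - r - k} ∧
      Module.finrank ℝ
          ↥(Dspace X Finset.univ (basesOn X Finset.univ) ⊓
            MvPolynomial.homogeneousSubmodule (Fin r) ℝ k)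
        = Set.ncard {B ∈ basesOn X Finset.univ |
            ((extSetOn X Finset.univ B).card : ℤ) = (N : ℤ) - r - k}) ∧
    Module.finrank ℝ ↥(PspaceOn X Finset.univ) = (basesOn X Finset.univ).ncard ∧
    Module.finrank ℝ ↥(Dspace X Finset.univ (basesOn X Finset.univ))
      = (basesOn X Finset.univ).ncard := by
  classical
  cases nonempty_fintype (basesOn X Finset.univ)
  have hP := DahmenMicchelli.linearIndependent_QB hX
  obtain ⟨w, hw, hwd, hwD⟩ := DahmenMicchelli.exists_homogeneous_basis_Dspace hX
  rw [DahmenMicchelli.PspaceOn_eq_span, ← hwD]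
  refine ⟨fun k => ⟨?_, ?_⟩, ?_, ?_⟩
  · rw [← DahmenMicchelli.card_degQ_eq_ncard k]
    exact DahmenMicchelli.finrank_span_inf_homogeneousSubmodule hP
      (fun B => DahmenMicchelli.QB_isHomogeneous X B) k
  · rw [← DahmenMicchelli.card_degQ_eq_ncard k]
    exact DahmenMicchelli.finrank_span_inf_homogeneousSubmodule hw hwd k
  · rw [finrank_span_eq_card hP, ← Nat.card_eq_fintype_card, Nat.card_coe_set_eq]
  · rw [finrank_span_eq_card hw, ← Nat.card_eq_fintype_card, Nat.card_coe_set_eq]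
end
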